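/- arXiv:2201.07579 — 2 statements merged into one kernel-verified Lean document; each statement's English description precedes it below -/
import Mathlib

section
/- Let 0 ≤ s ≤ n ≤ m, 0 ≤ k ≤ m, and let C = Mat(⟨e_1,…,e_s⟩) + Mat(⟨e_1,…,e_k⟩)^t ⊆ F_q^{n×m}. For 1 ≤ r ≤ min{s+k, n}, the number A_r of matrices of rank r in C is A_r = φ_q(s,m,r) + Σ_{i=1}^{min{n−s,k,r}} binom(k,i)_q · binom(m−i,r−i)_q · q^{si} · ∏_{t=0}^{i−1}(q^{n−s} − q^t) · ∏_{j=0}^{r−i−1}(q^{s} − q^j). -/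
open Matrix

/-- The maximum rank of a rank-metric code (an `𝔽`-linear subspace of `n × m` matrices). -/
noncomputable def maxrk {𝔽 : Type*} [Field 𝔽] {n m : ℕ}
    (C : Submodule 𝔽 (Matrix (Fin n) (Fin m) 𝔽)) : ℕ :=
  sSup (Matrix.rank '' (C : Set (Matrix (Fin n) (Fin m) 𝔽)))

/-- The dual code with respect to the trace bilinear form `⟨M, N⟩ = Tr(M Nᵗ)`. -/
def dualCode {𝔽 : Type*} [Field 𝔽] {n m : ℕ}
    (C : Submodule 𝔽 (Matrix (Fin n) (Fin m) 𝔽)) :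
    Submodule 𝔽 (Matrix (Fin n) (Fin m) 𝔽) where
  carrier := {M | ∀ N ∈ C, Matrix.trace (M * Nᵀ) = 0}
  add_mem' := by
    intro a b ha hb N hN
    show Matrix.trace ((a + b) * Nᵀ) = 0
    rw [Matrix.add_mul, Matrix.trace_add, ha N hN, hb N hN, add_zero]
  zero_mem' := by
    intro N hN
    simp
  smul_mem' := by
    intro c a ha N hN
    show Matrix.trace ((c • a) * Nᵀ) = 0
    rw [Matrix.smul_mul, Matrix.trace_smul, ha N hN, smul_zero]

/-- `C` is an optimal anticode if `dim C = m * maxrk C`. -/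
def isOptAnticode {𝔽 : Type*} [Field 𝔽] {n m : ℕ}
    (C : Submodule 𝔽 (Matrix (Fin n) (Fin m) 𝔽)) : Prop :=
  Module.finrank 𝔽 C = m * maxrk C

/-- `C` is a quasi optimal anticode if `m ∤ dim C` and `maxrk C = ⌈dim C / m⌉`. -/
def isQOAC {𝔽 : Type*} [Field 𝔽] {n m : ℕ}
    (C : Submodule 𝔽 (Matrix (Fin n) (Fin m) 𝔽)) : Prop :=
  ¬ (m ∣ Module.finrank 𝔽 C) ∧
    (maxrk C : ℤ) = ⌈(Module.finrank 𝔽 C : ℚ) / (m : ℚ)⌉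

/-- `C` is a dually quasi optimal anticode if both `C` and `C^⊥` are qOACs. -/
def isDuallyQOAC {𝔽 : Type*} [Field 𝔽] {n m : ℕ}
    (C : Submodule 𝔽 (Matrix (Fin n) (Fin m) 𝔽)) : Prop :=
  isQOAC C ∧ isQOAC (dualCode C)

/-- The code of matrices vanishing at all positions `(i, j)` with `¬ P i j`. -/
def zeroOutside {𝔽 : Type*} [Field 𝔽] {n m : ℕ} (P : Fin n → Fin m → Prop) :
    Submodule 𝔽 (Matrix (Fin n) (Fin m) 𝔽) where
  carrier := {M | ∀ i j, ¬ P i j → M i j = 0}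
  add_mem' := by
    intro a b ha hb i j h
    simp [Matrix.add_apply, ha i j h, hb i j h]
  zero_mem' := by
    intro i j h
    simp
  smul_mem' := by
    intro c a ha i j h
    simp [Matrix.smul_apply, ha i j h]

/-- `Mat(V)`: the matrices all of whose columns lie in `V ⊆ 𝔽^n`. -/
def matCol {𝔽 : Type*} [Field 𝔽] {n m : ℕ} (V : Submodule 𝔽 (Fin n → 𝔽)) :
    Submodule 𝔽 (Matrix (Fin n) (Fin m) 𝔽) where
  carrier := {M | ∀ j, (fun i => M i j) ∈ V}
  add_mem' := by
    intro a b ha hb j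
    exact V.add_mem (ha j) (hb j)
  zero_mem' := by
    intro j
    exact V.zero_mem
  smul_mem' := by
    intro c a ha j
    exact V.smul_mem c (ha j)

/-- `Mat(U)ᵗ`: the matrices all of whose rows lie in `U ⊆ 𝔽^m`. -/
def matRow {𝔽 : Type*} [Field 𝔽] {n m : ℕ} (U : Submodule 𝔽 (Fin m → 𝔽)) :
    Submodule 𝔽 (Matrix (Fin n) (Fin m) 𝔽) where
  carrier := {M | ∀ i, M i ∈ U}
  add_mem' := by
    intro a b ha hb i
    exact U.add_mem (ha i) (hb i)
  zero_mem' := by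
    intro i
    exact U.zero_mem
  smul_mem' := by
    intro c a ha i
    exact U.smul_mem c (ha i)

/-- `⟨e_1, …, e_s⟩ ⊆ 𝔽^ℓ`: the span of the first `s` canonical basis vectors. -/
def spanFirst (𝔽 : Type*) [Field 𝔽] (ℓ s : ℕ) : Submodule 𝔽 (Fin ℓ → 𝔽) :=
  Submodule.span 𝔽 ((fun i : Fin ℓ => Pi.single i (1 : 𝔽)) '' {i : Fin ℓ | (i : ℕ) < s})

/-- Orthogonal complement with respect to the standard dot product on `𝔽^ℓ`. -/
def perp {𝔽 : Type*} [Field 𝔽] {ℓ : ℕ} (W : Submodule 𝔽 (Fin ℓ → 𝔽)) :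
    Submodule 𝔽 (Fin ℓ → 𝔽) where
  carrier := {v | ∀ w ∈ W, ∑ i, v i * w i = 0}
  add_mem' := by
    intro a b ha hb w hw
    simp [add_mul, Finset.sum_add_distrib, ha w hw, hb w hw]
  zero_mem' := by
    intro w hw
    simp
  smul_mem' := by
    intro c a ha w hw
    simp [mul_assoc, ← Finset.mul_sum, ha w hw]

/-- Equivalence of rank-metric codes: `C = {N A M : A ∈ D}` for invertible `N, M`, or
(when `n = m`) `C = {N Aᵗ M : A ∈ D}` for invertible `N, M`. -/
def equivCode {𝔽 : Type*} [Field 𝔽] {n m : ℕ}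
    (C D : Submodule 𝔽 (Matrix (Fin n) (Fin m) 𝔽)) : Prop :=
  (∃ (N : Matrix (Fin n) (Fin n) 𝔽) (M : Matrix (Fin m) (Fin m) 𝔽),
      IsUnit N ∧ IsUnit M ∧
      (C : Set (Matrix (Fin n) (Fin m) 𝔽)) = (fun A : Matrix (Fin n) (Fin m) 𝔽 => N * A * M) '' (D : Set (Matrix (Fin n) (Fin m) 𝔽))) ∨
  (∃ (h : n = m) (N : Matrix (Fin n) (Fin n) 𝔽) (M : Matrix (Fin m) (Fin m) 𝔽),
      IsUnit N ∧ IsUnit M ∧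
      (C : Set (Matrix (Fin n) (Fin m) 𝔽)) =
        (fun A : Matrix (Fin n) (Fin m) 𝔽 =>
          N * (Matrix.reindex (finCongr h.symm) (finCongr h) Aᵀ) * M) ''
          (D : Set (Matrix (Fin n) (Fin m) 𝔽)))

/-- The Gaussian `q`-binomial coefficient, as a rational number. -/
def gaussBinom (q a r : ℕ) : ℚ :=
  (∏ i ∈ Finset.range r, ((q : ℚ) ^ a - (q : ℚ) ^ i)) /
    (∏ i ∈ Finset.range r, ((q : ℚ) ^ r - (q : ℚ) ^ i))

/-- `φ_q(a, b, r)`: the number of rank-`r` matrices in `𝔽_q^{a×b}`. -/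
def phiq (q a b r : ℕ) : ℚ :=
  gaussBinom q a r * ∏ i ∈ Finset.range r, ((q : ℚ) ^ b - (q : ℚ) ^ i)

section RankCount

open Module Submodule

theorem mem_spanFirst {𝔽 : Type*} [Field 𝔽] {l s : ℕ} {v : Fin l → 𝔽} :
    v ∈ spanFirst 𝔽 l s ↔ ∀ i : Fin l, s ≤ i → v i = 0 := by
  constructor
  · intro hv i hi
    refine Submodule.span_induction (p := fun w _ => w i = 0) ?_ rfl ?_ ?_ hv
    · rintro _ ⟨j, hj, rfl⟩
      have hij : i ≠ j := by
        rintro rfl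
        exact absurd hj (not_lt.mpr hi)
      simp [hij]
    · intro x y _ _ hx hy
      simp [hx, hy]
    · intro c x _ hx
      simp [hx]
  · intro h
    rw [pi_eq_sum_univ' v]
    refine Submodule.sum_mem _ fun i _ => ?_
    by_cases hi : (i : ℕ) < s
    · refine Submodule.smul_mem _ _ (Submodule.subset_span ⟨i, hi, ?_⟩)
      ext j
      simp [Pi.single_apply, eq_comm]
    · simp [h i (not_lt.mp hi)]

theorem finrank_spanFirst {𝔽 : Type*} [Field 𝔽] {l s : ℕ} (h : s ≤ l) :
    finrank 𝔽 (spanFirst 𝔽 l s) = s := by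
  have hr : (fun i : Fin l => (Pi.single i 1 : Fin l → 𝔽)) '' {i : Fin l | (i : ℕ) < s} =
      Set.range fun i : Fin s => (Pi.single (Fin.castLE h i) 1 : Fin l → 𝔽) := by
    ext v
    constructor
    · rintro ⟨i, hi, rfl⟩
      exact ⟨⟨i, hi⟩, rfl⟩
    · rintro ⟨i, rfl⟩
      exact ⟨Fin.castLE h i, i.2, rfl⟩
  have hli : LinearIndependent 𝔽 fun i : Fin s => (Pi.single (Fin.castLE h i) 1 : Fin l → 𝔽) :=
    (Pi.linearIndependent_single_one (Fin l) 𝔽).comp _ (Fin.castLE_injective h)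
  rw [spanFirst, hr, finrank_span_eq_card hli, Fintype.card_fin]

theorem mem_matCol_sup_matRow {𝔽 : Type*} [Field 𝔽] {n m s k : ℕ}
    {M : Matrix (Fin n) (Fin m) 𝔽} :
    M ∈ matCol (spanFirst 𝔽 n s) ⊔ matRow (spanFirst 𝔽 m k) ↔
      ∀ i : Fin n, s ≤ i → M i ∈ spanFirst 𝔽 m k := by
  constructor
  · intro hM i hi
    obtain ⟨A, hA, B, hB, rfl⟩ := Submodule.mem_sup.mp hM
    have h0 : A i = 0 := funext fun j => mem_spanFirst.mp (hA j) i hi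
    show A i + B i ∈ _
    rw [h0, zero_add]
    exact hB i
  · intro h
    refine Submodule.mem_sup.mpr ⟨fun i => if s ≤ (i : ℕ) then 0 else M i, ?_,
      fun i => if s ≤ (i : ℕ) then M i else 0, ?_, ?_⟩
    · intro j
      refine mem_spanFirst.mpr fun i hi => ?_
      simp [hi]
    · intro i
      by_cases hi : s ≤ (i : ℕ)
      · simpa [hi] using h i hi
      · simp [hi]
    · funext i
      show (if s ≤ (i : ℕ) then 0 else M i) + (if s ≤ (i : ℕ) then M i else 0) = M i
      by_cases hi : s ≤ (i : ℕ) <;> simp [hi]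

theorem prod_qpow_succ_sub (q : ℚ) (a d : ℕ) :
    ∏ j ∈ Finset.range (d + 1), (q ^ (a + 1) - q ^ j) =
      (q ^ (a + 1) - 1) * q ^ d * ∏ j ∈ Finset.range d, (q ^ a - q ^ j) := by
  rw [Finset.prod_range_succ', mul_assoc, mul_comm, pow_zero]
  congr 1
  rw [← Finset.card_range d, ← Finset.prod_const, Finset.card_range, ← Finset.prod_mul_distrib]
  exact Finset.prod_congr rfl fun j _ => by ring

theorem prod_qpow_recursion (q : ℚ) (a d : ℕ) :
    ∏ j ∈ Finset.range (d + 1), (q ^ (a + 1) - q ^ j) =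
      ∏ j ∈ Finset.range (d + 1), (q ^ a - q ^ j) +
        (q ^ (d + 1) - 1) * q ^ a * ∏ j ∈ Finset.range d, (q ^ a - q ^ j) := by
  rw [prod_qpow_succ_sub, Finset.prod_range_succ]
  ring

theorem prod_qpow_self_ne_zero {q : ℕ} (hq : 1 < q) (d : ℕ) :
    ∏ j ∈ Finset.range d, ((q : ℚ) ^ d - (q : ℚ) ^ j) ≠ 0 := by
  refine Finset.prod_ne_zero_iff.mpr fun j hj => sub_ne_zero.mpr (ne_of_gt ?_)
  exact pow_lt_pow_right₀ (by exact_mod_cast hq) (Finset.mem_range.mp hj)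

theorem gaussBinom_succ_succ {q : ℕ} (hq : 1 < q) (a d : ℕ) :
    gaussBinom q (a + 1) (d + 1) * ((q : ℚ) ^ (d + 1) - 1) =
      ((q : ℚ) ^ (a + 1) - 1) * gaussBinom q a d := by
  have h1 : (q : ℚ) ^ (d + 1) - 1 ≠ 0 :=
    sub_ne_zero.mpr (ne_of_gt (one_lt_pow₀ (by exact_mod_cast hq) (by omega)))
  have h2 := prod_qpow_self_ne_zero hq d
  have h3 : (q : ℚ) ≠ 0 := by positivity
  rw [gaussBinom, gaussBinom, prod_qpow_succ_sub, prod_qpow_succ_sub]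
  field_simp

theorem gaussBinom_zero_succ (q d : ℕ) : gaussBinom q 0 (d + 1) = 0 := by
  rw [gaussBinom, Finset.prod_range_succ']
  simp

open Classical in
/-- The number of `a`-tuples of vectors which together with a fixed `W` span a subspace of
dimension `r`. -/
theorem card_tuples_finrank_sup_span {𝔽 V : Type*} [Field 𝔽] [Fintype 𝔽] [AddCommGroup V]
    [Module 𝔽 V] [Fintype V] (a r : ℕ) (W : Submodule 𝔽 V) :
    (∑ v : Fin a → V, if finrank 𝔽 ↥(W ⊔ span 𝔽 (Set.range v)) = r then (1 : ℚ) else 0) =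
      if finrank 𝔽 W ≤ r then
        (Fintype.card 𝔽 : ℚ) ^ (a * finrank 𝔽 W) *
          gaussBinom (Fintype.card 𝔽) (finrank 𝔽 V - finrank 𝔽 W) (r - finrank 𝔽 W) *
          ∏ j ∈ Finset.range (r - finrank 𝔽 W),
            ((Fintype.card 𝔽 : ℚ) ^ a - (Fintype.card 𝔽 : ℚ) ^ j)
      else 0 := by
  have hq : 1 < Fintype.card 𝔽 := Fintype.one_lt_card
  induction a generalizing W with
  | zero =>
    have hW (v : Fin 0 → V) : finrank 𝔽 ↥(W ⊔ span 𝔽 (Set.range v)) = finrank 𝔽 W := by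
      rw [Set.range_eq_empty, span_empty, sup_bot_eq]
    simp only [hW]
    rcases lt_trichotomy (finrank 𝔽 W) r with h | h | h
    · obtain ⟨d, rfl⟩ := Nat.exists_eq_add_of_lt h
      simp [add_assoc, Finset.prod_range_succ']
    · simp [h, gaussBinom]
    · simp [h.ne', h.not_ge]
  | succ a ih =>
    have hcons (x : V) (v : Fin a → V) :
        finrank 𝔽 ↥(W ⊔ span 𝔽 (Set.range (Fin.consEquiv (fun _ => V) (x, v)))) =
          finrank 𝔽 ↥((W ⊔ span 𝔽 {x}) ⊔ span 𝔽 (Set.range v)) := by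
      rw [show Fin.consEquiv (fun _ : Fin (a + 1) => V) (x, v) = Fin.cons x v from rfl,
        Fin.range_cons, Set.insert_eq, span_union, sup_assoc]
    rw [← (Fin.consEquiv fun _ : Fin (a + 1) => V).sum_comp, Fintype.sum_prod_type]
    simp only [hcons, ih]
    have hin (x : V) (hx : x ∈ W) : finrank 𝔽 ↥(W ⊔ span 𝔽 {x}) = finrank 𝔽 W := by
      rw [sup_eq_left.mpr ((span_singleton_le_iff_mem x W).mpr hx)]
    have hout (x : V) (hx : x ∉ W) : finrank 𝔽 ↥(W ⊔ span 𝔽 {x}) = finrank 𝔽 W + 1 := by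
      have hx0 : x ≠ 0 := fun h => hx (h ▸ W.zero_mem)
      have h := Submodule.finrank_sup_add_finrank_inf_eq W (span 𝔽 {x})
      have hd : W ⊓ span 𝔽 {x} = ⊥ :=
        ((Submodule.disjoint_span_singleton' hx0).mpr hx).eq_bot
      rw [hd, finrank_bot, finrank_span_singleton hx0] at h
      simpa using h
    have hcardV : (Fintype.card V : ℚ) = (Fintype.card 𝔽 : ℚ) ^ finrank 𝔽 V := by
      rw [Module.card_eq_pow_finrank (K := 𝔽) (V := V)]
      push_cast
      rfl
    have hcardW : ((Finset.univ.filter fun x => x ∈ W).card : ℚ) =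
        (Fintype.card 𝔽 : ℚ) ^ finrank 𝔽 W := by
      rw [← Fintype.card_subtype, Module.card_eq_pow_finrank (K := 𝔽) (V := W)]
      push_cast
      rfl
    have hcardN : ((Finset.univ.filter fun x => x ∉ W).card : ℚ) =
        (Fintype.card 𝔽 : ℚ) ^ finrank 𝔽 V - (Fintype.card 𝔽 : ℚ) ^ finrank 𝔽 W := by
      rw [← hcardV, ← hcardW, eq_sub_iff_add_eq', ← Finset.card_univ]
      exact_mod_cast Finset.card_filter_add_card_filter_not (s := Finset.univ) (fun x => x ∈ W)
    rw [← Finset.sum_filter_add_sum_filter_not Finset.univ (fun x => x ∈ W),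
      Finset.sum_congr rfl (fun x hx => by rw [hin x (Finset.mem_filter.mp hx).2]),
      Finset.sum_congr (s₁ := Finset.univ.filter fun x => x ∉ W) rfl
        (fun x hx => by rw [hout x (Finset.mem_filter.mp hx).2]),
      Finset.sum_const, Finset.sum_const, nsmul_eq_mul, nsmul_eq_mul, hcardW, hcardN]
    obtain ⟨c, hc⟩ := Nat.exists_eq_add_of_le (Submodule.finrank_le W)
    rw [hc]
    generalize finrank 𝔽 W = i
    rcases lt_trichotomy i r with h | h | h
    · obtain ⟨d, rfl⟩ := Nat.exists_eq_add_of_lt h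
      have e1 : i + d + 1 - i = d + 1 := by omega
      have e2 : i + d + 1 - (i + 1) = d := by omega
      have e3 : i + c - i = c := by omega
      have e4 : i + c - (i + 1) = c - 1 := by omega
      rw [if_pos (by omega), if_pos (by omega), if_pos (by omega), e1, e2, e3, e4,
        prod_qpow_recursion]
      cases c with
      | zero => simp [gaussBinom_zero_succ]
      | succ c =>
        have hg := gaussBinom_succ_succ hq c d
        rw [Nat.add_sub_cancel, mul_add, add_mul a 1 i]
        simp only [pow_add, one_mul, mul_one] at hg ⊢
        linear_combination (-(Fintype.card 𝔽 : ℚ) ^ (a * i) * (Fintype.card 𝔽 : ℚ) ^ i *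
          (Fintype.card 𝔽 : ℚ) ^ a * ∏ j ∈ Finset.range d,
            ((Fintype.card 𝔽 : ℚ) ^ a - (Fintype.card 𝔽 : ℚ) ^ j)) * hg
    · subst h
      simp [gaussBinom]
      ring
    · rw [if_neg (by omega), if_neg (by omega), if_neg (by omega)]
      simp

open Classical in
theorem card_matCol_sup_matRow_rank {𝔽 : Type*} [Field 𝔽] [Fintype 𝔽] (s b m k r : ℕ) :
    (Nat.card {M : Matrix (Fin (s + b)) (Fin m) 𝔽 //
        M ∈ matCol (spanFirst 𝔽 (s + b) s) ⊔ matRow (spanFirst 𝔽 m k) ∧ M.rank = r} : ℚ) =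
      ∑ D : Fin b → spanFirst 𝔽 m k, ∑ t : Fin s → Fin m → 𝔽,
        if finrank 𝔽 ↥((span 𝔽 (Set.range D)).map (spanFirst 𝔽 m k).subtype ⊔
          span 𝔽 (Set.range t)) = r then (1 : ℚ) else 0 := by
  rw [← Fintype.sum_prod_type', Finset.sum_boole, ← Fintype.card_subtype,
    ← Nat.card_eq_fintype_card, Nat.cast_inj]
  have hspan (D : Fin b → spanFirst 𝔽 m k) (t : Fin s → Fin m → 𝔽) :
      (span 𝔽 (Set.range D)).map (spanFirst 𝔽 m k).subtype ⊔ span 𝔽 (Set.range t) =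
        span 𝔽 (Set.range (Fin.append t fun i => (D i : Fin m → 𝔽))) := by
    rw [Submodule.map_span, ← span_union, ← Set.range_comp, Set.union_comm]
    congr 1
    ext v
    simp only [Set.mem_union, Set.mem_range]
    constructor
    · rintro (⟨i, rfl⟩ | ⟨i, rfl⟩)
      · exact ⟨Fin.castAdd b i, Fin.append_left _ _ i⟩
      · exact ⟨Fin.natAdd s i, Fin.append_right _ _ i⟩
    · rintro ⟨i, rfl⟩
      refine Fin.addCases (fun i => Or.inl ⟨i, ?_⟩) (fun i => Or.inr ⟨i, ?_⟩) i <;> simp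
  symm
  refine Nat.card_eq_of_bijective
    (fun p => ⟨Matrix.of (Fin.append p.1.2 fun i => (p.1.1 i : Fin m → 𝔽)),
      mem_matCol_sup_matRow.mpr ?_, ?_⟩) ⟨?_, ?_⟩
  · intro i
    refine Fin.addCases (fun i hi => ?_) (fun i _ => ?_) i
    · exact absurd hi (by simp)
    · show Fin.append p.1.2 (fun i => (p.1.1 i : Fin m → 𝔽)) (Fin.natAdd s i) ∈ spanFirst 𝔽 m k
      rw [Fin.append_right]
      exact (p.1.1 i).2
  · rw [Matrix.rank_eq_finrank_span_row]
    exact hspan p.1.1 p.1.2 ▸ p.2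
  · rintro ⟨⟨D, t⟩, h⟩ ⟨⟨D', t'⟩, h'⟩ e
    have e' : Fin.append t (fun i => (D i : Fin m → 𝔽)) = Fin.append t' fun i => (D' i : Fin m → 𝔽) :=
      congrArg Subtype.val e
    have ht : t = t' := funext fun i => by
      simpa using congrFun e' (Fin.castAdd b i)
    have hD : D = D' := funext fun i => Subtype.ext <| by
      simpa using congrFun e' (Fin.natAdd s i)
    simp [ht, hD]
  · rintro ⟨M, hM, hr⟩
    have hM' := mem_matCol_sup_matRow.mp hM
    have hMa : Fin.append (fun i => M (Fin.castAdd b i)) (fun i => M (Fin.natAdd s i)) = M :=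
      Fin.append_castAdd_natAdd
    refine ⟨⟨(fun i => ⟨M (Fin.natAdd s i), hM' _ (by simp)⟩, fun i => M (Fin.castAdd b i)), ?_⟩,
      Subtype.ext hMa⟩
    rw [hspan]
    rw [Matrix.rank_eq_finrank_span_row] at hr
    exact (congrArg (fun v => finrank 𝔽 ↥(span 𝔽 (Set.range v))) hMa).trans hr

end RankCount

/-- Rank distribution of `C = Mat(⟨e_1,…,e_s⟩) + Mat(⟨e_1,…,e_k⟩)ᵗ`. -/
theorem stmt10 {𝔽 : Type*} [Field 𝔽] [Fintype 𝔽] {n m s k : ℕ}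
    (hsn : s ≤ n) (hnm : n ≤ m) (hkm : k ≤ m)
    (C : Submodule 𝔽 (Matrix (Fin n) (Fin m) 𝔽))
    (hC : C = matCol (spanFirst 𝔽 n s) ⊔ matRow (spanFirst 𝔽 m k)) :
    ∀ r : ℕ, 1 ≤ r → r ≤ min (s + k) n →
      (Nat.card {M : Matrix (Fin n) (Fin m) 𝔽 // M ∈ C ∧ M.rank = r} : ℚ) =
        phiq (Fintype.card 𝔽) s m r +
        ∑ i ∈ Finset.Icc 1 (min (min (n - s) k) r),
          gaussBinom (Fintype.card 𝔽) k i * gaussBinom (Fintype.card 𝔽) (m - i) (r - i) *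
          (Fintype.card 𝔽 : ℚ) ^ (s * i) *
          (∏ t ∈ Finset.range i,
            ((Fintype.card 𝔽 : ℚ) ^ (n - s) - (Fintype.card 𝔽 : ℚ) ^ t)) *
          (∏ j ∈ Finset.range (r - i),
            ((Fintype.card 𝔽 : ℚ) ^ s - (Fintype.card 𝔽 : ℚ) ^ j)) := by
  classical
  intro r hr1 _
  obtain ⟨b, rfl⟩ := Nat.exists_eq_add_of_le hsn
  subst hC
  set U := spanFirst 𝔽 m k with hU
  set q := Fintype.card 𝔽
  have hUk : Module.finrank 𝔽 U = k := finrank_spanFirst hkm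
  set f : ℕ → ℚ := fun i => if i ≤ r then (q : ℚ) ^ (s * i) * gaussBinom q (m - i) (r - i) *
    ∏ j ∈ Finset.range (r - i), ((q : ℚ) ^ s - (q : ℚ) ^ j) else 0 with hf
  have hcount (i : ℕ) : ((Finset.univ.filter fun D : Fin b → U =>
      Module.finrank 𝔽 (Submodule.span 𝔽 (Set.range D)) = i).card : ℚ) =
      gaussBinom q k i * ∏ t ∈ Finset.range i, ((q : ℚ) ^ b - (q : ℚ) ^ t) := by
    have h := card_tuples_finrank_sup_span (𝔽 := 𝔽) b i (⊥ : Submodule 𝔽 U)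
    have hbot (D : Fin b → U) : Module.finrank 𝔽 ↥(⊥ ⊔ Submodule.span 𝔽 (Set.range D)) =
        Module.finrank 𝔽 (Submodule.span 𝔽 (Set.range D)) := by
      rw [bot_sup_eq]
    simpa [hbot, Finset.sum_boole, hUk, q] using h
  have hmaps (D : Fin b → U) :
      Module.finrank 𝔽 (Submodule.span 𝔽 (Set.range D)) ∈ Finset.range (min b k + 1) := by
    rw [Finset.mem_range, Nat.lt_succ_iff]
    refine le_min ?_ (hUk ▸ Submodule.finrank_le _)
    exact (finrank_range_le_card (R := 𝔽) D).trans_eq (Fintype.card_fin b)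
  have htotal : (Nat.card {M : Matrix (Fin (s + b)) (Fin m) 𝔽 //
      M ∈ matCol (spanFirst 𝔽 (s + b) s) ⊔ matRow U ∧ M.rank = r} : ℚ) =
      ∑ i ∈ Finset.range (min b k + 1),
        (gaussBinom q k i * ∏ t ∈ Finset.range i, ((q : ℚ) ^ b - (q : ℚ) ^ t)) * f i := by
    rw [card_matCol_sup_matRow_rank]
    simp only [card_tuples_finrank_sup_span, Module.finrank_fin_fun]
    rw [← Finset.sum_fiberwise_of_maps_to (fun D _ => hmaps D)]
    refine Finset.sum_congr rfl fun i _ => ?_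
    rw [← hcount, ← nsmul_eq_mul, ← Finset.sum_const]
    refine Finset.sum_congr rfl fun D hD => ?_
    have hD' : Module.finrank 𝔽 ↥((Submodule.span 𝔽 (Set.range D)).map U.subtype) = i :=
      (Submodule.finrank_map_subtype_eq U _).trans (Finset.mem_filter.mp hD).2
    rw [hD']
  have hrange : ∑ i ∈ Finset.range (min b k + 1),
        (gaussBinom q k i * ∏ t ∈ Finset.range i, ((q : ℚ) ^ b - (q : ℚ) ^ t)) * f i =
      ∑ i ∈ Finset.range (min (min b k) r + 1),
        (gaussBinom q k i * ∏ t ∈ Finset.range i, ((q : ℚ) ^ b - (q : ℚ) ^ t)) * f i := by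
    symm
    refine Finset.sum_subset (Finset.range_mono (by omega)) fun i hi hi' => ?_
    rw [Finset.mem_range] at hi hi'
    simp only [hf]
    rw [if_neg (by omega), mul_zero]
  rw [htotal, hrange, Nat.add_sub_cancel_left, Finset.range_eq_Ico,
    Finset.sum_eq_sum_Ico_succ_bot (Nat.succ_pos _)]
  congr 1
  · simp [hf, phiq, gaussBinom]
    ring
  · refine Finset.sum_congr (by ext; simp) fun i hi => ?_
    have hi' := Finset.mem_Icc.mp hi
    simp only [hf]
    rw [if_pos (by omega)]
    ring
end

section
/- Let C ⊆ F_2^{4×4} be the 9-dimensional F_2-linear code of all matrices of the form [[a1, a4, a5, a6],[0, a2, a7, a8],[0, 0, a2+a3, a9],[0, 0, 0, a3]] with a1,…,a9 ∈ F_2. Then maxrk(C) = 3 and dim(C) = 9 (so C is a qOAC), and for every 0 ≤ s ≤ 3, C is not equivalent to any linear subspace of Mat(⟨e_1,…,e_s⟩) + Mat(⟨e_1,…,e_{3−s}⟩)^t. -/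
open Matrix

/-- The 9-dimensional binary code of Example 2.11: matrices of the form
`[[a1, a4, a5, a6], [0, a2, a7, a8], [0, 0, a2+a3, a9], [0, 0, 0, a3]]`. -/
def exCode : Submodule (ZMod 2) (Matrix (Fin 4) (Fin 4) (ZMod 2)) where
  carrier := {M | M 1 0 = 0 ∧ M 2 0 = 0 ∧ M 2 1 = 0 ∧ M 3 0 = 0 ∧ M 3 1 = 0 ∧ M 3 2 = 0 ∧
    M 2 2 = M 1 1 + M 3 3}
  add_mem' := by
    rintro a b ⟨ha1, ha2, ha3, ha4, ha5, ha6, ha7⟩ ⟨hb1, hb2, hb3, hb4, hb5, hb6, hb7⟩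
    refine ⟨?_, ?_, ?_, ?_, ?_, ?_, ?_⟩
    · simp [Matrix.add_apply, ha1, hb1]
    · simp [Matrix.add_apply, ha2, hb2]
    · simp [Matrix.add_apply, ha3, hb3]
    · simp [Matrix.add_apply, ha4, hb4]
    · simp [Matrix.add_apply, ha5, hb5]
    · simp [Matrix.add_apply, ha6, hb6]
    · simp only [Matrix.add_apply, ha7, hb7]; ring
  zero_mem' := by
    refine ⟨?_, ?_, ?_, ?_, ?_, ?_, ?_⟩ <;> simp
  smul_mem' := by
    rintro c a ⟨ha1, ha2, ha3, ha4, ha5, ha6, ha7⟩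
    refine ⟨?_, ?_, ?_, ?_, ?_, ?_, ?_⟩
    · simp [Matrix.smul_apply, ha1]
    · simp [Matrix.smul_apply, ha2]
    · simp [Matrix.smul_apply, ha3]
    · simp [Matrix.smul_apply, ha4]
    · simp [Matrix.smul_apply, ha5]
    · simp [Matrix.smul_apply, ha6]
    · simp only [Matrix.smul_apply, ha7, smul_eq_mul]; ring

theorem Matrix.det_eq_zero_of_zero_block {n R : Type*} [Fintype n] [DecidableEq n] [CommRing R]
    (A : Matrix n n R) (S T : Finset n) (hcard : Fintype.card n < S.card + T.card)
    (h : ∀ i ∈ S, ∀ j ∈ T, A i j = 0) : A.det = 0 := by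
  rw [Matrix.det_apply']
  refine Finset.sum_eq_zero fun σ _ => ?_
  obtain ⟨j, hjT, hjS⟩ : ∃ j ∈ T, σ j ∈ S := by
    by_contra! hc
    have hdisj : Disjoint (T.map σ.toEmbedding) S := by
      rw [Finset.disjoint_left]
      intro x hx
      obtain ⟨j, hj, rfl⟩ := Finset.mem_map.1 hx
      exact hc j hj
    have hle := (T.map σ.toEmbedding ∪ S).card_le_univ
    rw [Finset.card_union_of_disjoint hdisj, Finset.card_map] at hle
    omega
  exact mul_eq_zero_of_right _ (Finset.prod_eq_zero (Finset.mem_univ j) (h _ hjS _ hjT))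

theorem Matrix.exists_ne_zero_of_isUnit {n R : Type*} [Fintype n] [DecidableEq n] [CommRing R]
    [Nontrivial R] {A : Matrix n n R} (hA : IsUnit A) (S T : Finset n)
    (hcard : Fintype.card n < S.card + T.card) : ∃ i ∈ S, ∃ j ∈ T, A i j ≠ 0 := by
  by_contra! h
  have hdet := (Matrix.isUnit_iff_isUnit_det A).1 hA
  rw [A.det_eq_zero_of_zero_block S T hcard h] at hdet
  exact not_isUnit_zero hdet

theorem Matrix.isUnit_of_card_le_rank {n K : Type*} [Fintype n] [DecidableEq n] [Field K]
    {A : Matrix n n K} (h : Fintype.card n ≤ A.rank) : IsUnit A := by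
  have hr : A.rank = Module.finrank K (n → K) := by
    rw [Module.finrank_fintype_fun_eq_card]
    exact le_antisymm A.rank_le_card_width h
  rw [← Matrix.mulVec_surjective_iff_isUnit]
  exact LinearMap.range_eq_top.1 (Submodule.eq_top_of_finrank_eq hr)

theorem mem_exCode {M : Matrix (Fin 4) (Fin 4) (ZMod 2)} :
    M ∈ exCode ↔ M 1 0 = 0 ∧ M 2 0 = 0 ∧ M 2 1 = 0 ∧ M 3 0 = 0 ∧ M 3 1 = 0 ∧ M 3 2 = 0 ∧
      M 2 2 = M 1 1 + M 3 3 :=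
  Iff.rfl

theorem det_eq_zero_of_mem_exCode {M : Matrix (Fin 4) (Fin 4) (ZMod 2)} (hM : M ∈ exCode) :
    M.det = 0 := by
  obtain ⟨h10, h20, h21, h30, h31, h32, h22⟩ := hM
  have htri : M.BlockTriangular id := by
    intro i j hij
    fin_cases i <;> fin_cases j <;> first | assumption | exact absurd hij (by decide)
  have hxy : ∀ x y : ZMod 2, x * (x + y) * y = 0 := by decide
  rw [Matrix.det_of_isUpperTriangular htri, Fin.prod_univ_four, h22]
  linear_combination M 0 0 * hxy (M 1 1) (M 3 3)

theorem rank_le_of_mem_exCode {M : Matrix (Fin 4) (Fin 4) (ZMod 2)} (hM : M ∈ exCode) :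
    M.rank ≤ 3 := by
  by_contra! h
  have hu := (Matrix.isUnit_iff_isUnit_det M).1
    (Matrix.isUnit_of_card_le_rank (by rw [Fintype.card_fin]; omega))
  rw [det_eq_zero_of_mem_exCode hM] at hu
  exact not_isUnit_zero hu

theorem maxrk_exCode : maxrk exCode = 3 := by
  refine IsGreatest.csSup_eq ⟨⟨Matrix.diagonal ![1, 1, 1, 0], ?_, ?_⟩, ?_⟩
  · exact mem_exCode.2 (by decide)
  · rw [Matrix.rank_diagonal]
    decide
  · rintro _ ⟨M, hM, rfl⟩
    exact rank_le_of_mem_exCode hM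

/-- The parametrization of `exCode` by its nine free entries. -/
def exCodeEquiv : exCode ≃ₗ[ZMod 2] (Fin 9 → ZMod 2) where
  toFun M := ![M.1 0 0, M.1 1 1, M.1 3 3, M.1 0 1, M.1 0 2, M.1 0 3, M.1 1 2, M.1 1 3, M.1 2 3]
  map_add' M N := by
    ext i
    fin_cases i <;> rfl
  map_smul' c M := by
    ext i
    fin_cases i <;> rfl
  invFun a := ⟨!![a 0, a 3, a 4, a 5; 0, a 1, a 6, a 7; 0, 0, a 1 + a 2, a 8; 0, 0, 0, a 2],
    rfl, rfl, rfl, rfl, rfl, rfl, rfl⟩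
  left_inv M := by
    obtain ⟨M, h10, h20, h21, h30, h31, h32, h22⟩ := M
    ext i j
    fin_cases i <;> fin_cases j <;> first | rfl | (symm; assumption)
  right_inv a := by
    ext i
    fin_cases i <;> rfl

theorem finrank_exCode : Module.finrank (ZMod 2) exCode = 9 := by
  rw [exCodeEquiv.finrank_eq, Module.finrank_fin_fun]

theorem single_mem_exCode {l k : Fin 4} (h : l < k) :
    Matrix.single l k (1 : ZMod 2) ∈ exCode := by
  rw [mem_exCode]
  revert l k
  decide

theorem exists_diagonal_mem_exCode (k : Fin 4) :
    ∃ d : Fin 4 → ZMod 2, d k = 1 ∧ Matrix.diagonal d ∈ exCode := by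
  simp only [mem_exCode]
  revert k
  decide

theorem exists_mem_exCode_dotProduct_ne_zero {p w : Fin 4 → ZMod 2} {s l k : Fin 4}
    (hl : l ≤ s) (hk : s ≤ k) (hp : p l ≠ 0) (hw : w k ≠ 0) :
    ∃ X ∈ exCode, p ⬝ᵥ X *ᵥ w ≠ 0 := by
  by_contra! h
  have hstrict : ∀ i j : Fin 4, i < j → p i * w j = 0 := fun i j hij => by
    have hij0 := h _ (single_mem_exCode hij)
    rw [Matrix.single_mulVec, one_mul] at hij0
    exact (dotProduct_single p (w j) i).symm.trans hij0
  obtain hlt | rfl := (hl.trans hk).lt_or_eq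
  · exact mul_ne_zero hp hw (hstrict l k hlt)
  · obtain ⟨d, hd, hX⟩ := exists_diagonal_mem_exCode l
    have hsum := h _ hX
    rw [dotProduct, Finset.sum_eq_single l] at hsum
    · rw [Matrix.mulVec_diagonal, hd, one_mul] at hsum
      exact mul_ne_zero hp hw hsum
    · intro i _ hi
      rw [Matrix.mulVec_diagonal]
      obtain hil | hil := lt_or_gt_of_ne hi
      · rw [(mul_eq_zero.1 (hstrict i l hil)).resolve_right hw, zero_mul]
      · rw [(mul_eq_zero.1 (hstrict l i hil)).resolve_left hp, mul_zero, mul_zero]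
    · exact fun hn => absurd (Finset.mem_univ l) hn

theorem apply_eq_zero_of_mem_spanFirst {𝔽 : Type*} [Field 𝔽] {n s : ℕ} {v : Fin n → 𝔽}
    (hv : v ∈ spanFirst 𝔽 n s) {i : Fin n} (hi : s ≤ i) : v i = 0 := by
  have hle : spanFirst 𝔽 n s ≤ LinearMap.ker (LinearMap.proj (R := 𝔽) (φ := fun _ => 𝔽) i) := by
    refine Submodule.span_le.2 ?_
    rintro _ ⟨j, hj, rfl⟩
    have hne : i ≠ j := fun hij => absurd (hij ▸ hj : (i : ℕ) < s) (by omega)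
    simp [hne]
  exact hle hv

theorem apply_eq_zero_of_mem_matCol_sup_matRow {𝔽 : Type*} [Field 𝔽] {n m s t : ℕ}
    {A : Matrix (Fin n) (Fin m) 𝔽} (hA : A ∈ matCol (spanFirst 𝔽 n s) ⊔ matRow (spanFirst 𝔽 m t))
    {i : Fin n} {j : Fin m} (hi : s ≤ i) (hj : t ≤ j) : A i j = 0 := by
  obtain ⟨B, hB, D, hD, rfl⟩ := Submodule.mem_sup.1 hA
  have hBij : B i j = 0 := apply_eq_zero_of_mem_spanFirst (hB j) hi
  have hDij : D i j = 0 := apply_eq_zero_of_mem_spanFirst (hD i) hj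
  rw [Matrix.add_apply, hBij, hDij, add_zero]

theorem exists_mem_exCode_block_ne_zero {P Q : Matrix (Fin 4) (Fin 4) (ZMod 2)} (hP : IsUnit P)
    (hQ : IsUnit Q) (s : Fin 4) :
    ∃ X ∈ exCode, ∃ i j : Fin 4, (s : ℕ) ≤ i ∧ 3 - (s : ℕ) ≤ j ∧ (P * X * Q) i j ≠ 0 := by
  obtain ⟨i, hi, l, hl, hp⟩ := Matrix.exists_ne_zero_of_isUnit hP
    {i : Fin 4 | s ≤ i} {l : Fin 4 | l ≤ s} (by revert s; decide)
  obtain ⟨k, hk, j, hj, hw⟩ := Matrix.exists_ne_zero_of_isUnit hQ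
    {k : Fin 4 | s ≤ k} {j : Fin 4 | 3 - (s : ℕ) ≤ j} (by clear hi hl; revert s; decide)
  rw [Finset.mem_filter_univ] at hi hl hk hj
  obtain ⟨X, hX, hne⟩ :=
    exists_mem_exCode_dotProduct_ne_zero (p := P i) (w := fun k => Q k j) hl hk hp hw
  exact ⟨X, hX, i, j, hi, hj, by rwa [Matrix.mul_assoc]⟩

theorem not_forall_exCode_eq_mul_mul {N M : Matrix (Fin 4) (Fin 4) (ZMod 2)} (hN : IsUnit N)
    (hM : IsUnit M) (s : Fin 4) :
    ¬ ∀ X ∈ exCode, ∃ A : Matrix (Fin 4) (Fin 4) (ZMod 2),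
      (∀ i j : Fin 4, (s : ℕ) ≤ i → 3 - (s : ℕ) ≤ j → A i j = 0) ∧ N * A * M = X := by
  intro h
  obtain ⟨N, rfl⟩ := hN
  obtain ⟨M, rfl⟩ := hM
  obtain ⟨X, hX, i, j, hi, hj, hne⟩ :=
    exists_mem_exCode_block_ne_zero (N⁻¹).isUnit (M⁻¹).isUnit s
  obtain ⟨A, hA, rfl⟩ := h X hX
  refine hne ?_
  rw [Matrix.mul_assoc, Units.mul_inv_cancel_right, Units.inv_mul_cancel_left]
  exact hA i j hi hj

/-- `exCode` is a qOAC with `maxrk = 3` and `dim = 9`, and is not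
equivalent to any subspace of `Mat(⟨e_1,…,e_s⟩) + Mat(⟨e_1,…,e_{3−s}⟩)ᵗ` for `0 ≤ s ≤ 3`. -/
theorem stmt19 (C : Submodule (ZMod 2) (Matrix (Fin 4) (Fin 4) (ZMod 2)))
    (hC : C = exCode) :
    maxrk C = 3 ∧ Module.finrank (ZMod 2) C = 9 ∧ isQOAC C ∧
      ∀ s : ℕ, s ≤ 3 →
        ∀ D : Submodule (ZMod 2) (Matrix (Fin 4) (Fin 4) (ZMod 2)),
          D ≤ matCol (spanFirst (ZMod 2) 4 s) ⊔ matRow (spanFirst (ZMod 2) 4 (3 - s)) →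
            ¬ equivCode C D := by
  subst hC
  refine ⟨maxrk_exCode, finrank_exCode, ⟨?_, ?_⟩, ?_⟩
  · rw [finrank_exCode]
    decide
  · rw [finrank_exCode, maxrk_exCode]
    norm_num [eq_comm, Int.ceil_eq_iff]
  · rintro s hs D hD (⟨N, M, hN, hM, h⟩ | ⟨_, N, M, hN, hM, h⟩)
    · refine not_forall_exCode_eq_mul_mul hN hM ⟨s, by omega⟩ fun X hX => ?_
      obtain ⟨A, hA, hAX⟩ := h.subset hX
      exact ⟨A, fun i j hi hj => apply_eq_zero_of_mem_matCol_sup_matRow (hD hA) hi hj, hAX⟩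
    · refine not_forall_exCode_eq_mul_mul hN hM ⟨3 - s, by omega⟩ fun X hX => ?_
      obtain ⟨A, hA, hAX⟩ := h.subset hX
      refine ⟨Aᵀ, fun i j hi hj => ?_, hAX⟩
      exact apply_eq_zero_of_mem_matCol_sup_matRow (hD hA) (by simp only at hj; omega) hi
end
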